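/- Let α > 0 and φ₀(m) = |m|^α m. Let k, k₁ ∈ ℤ with k, k₁ and k₂ := k − k₁ all nonzero, and let τ, τ₁, η, η₁ ∈ ℝ. Set σ := τ − φ(k,η), σ₁ := τ₁ − φ(k₁,η₁), σ₂ := (τ−τ₁) − φ(k₂, η−η₁), and r(k,k₁) := φ₀(k) − φ₀(k₁) − φ₀(k₂). Then the resonance identity σ₁ + σ₂ − σ = r(k,k₁) + (kη₁ − k₁η)²/(k·k₁·k₂) holds, the two terms on the right-hand side have the same sign, and consequently max(|σ|, |σ₁|, |σ₂|) ≥ (α/(3·2^α)) · |k_min| · |k_max|^α, where |k_min| and |k_max| denote respectively the smallest and the largest of |k|, |k₁|, |k₂|. -/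

import Mathlib

/- STATEMENT 17: the resonance identity and the lower resonance bound for the
   generalized KP-II phase function. -/

noncomputable section

open Real

/-- dispersion part `φ₀(m) = |m|^α m` -/
def phi0 (α : ℝ) (m : ℤ) : ℝ := |(m : ℝ)| ^ α * (m : ℝ)

/-- phase function `φ(k,η) = |k|^α k − η²/k` -/
def phi2 (α : ℝ) (k : ℤ) (η : ℝ) : ℝ := phi0 α k - η ^ 2 / (k : ℝ)

/-- Superadditivity defect of `x ↦ x ^ α * x` for positive arguments. -/
lemma defect_lower_bound_of_pos {α : ℝ} (hα : 0 < α) {a b : ℝ} (hb : 0 < b) (hab : b ≤ a) :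
    α / 2 ^ α * b * (a + b) ^ α ≤ (a + b) ^ α * (a + b) - a ^ α * a - b ^ α * b := by
  have ha : 0 < a := hb.trans_le hab
  have hc : 0 < a + b := by positivity
  have hhalf : ((a + b) / 2) ^ α = (a + b) ^ α / 2 ^ α := div_rpow hc.le (by norm_num) α
  have hbα : b ^ α ≤ (a + b) ^ α / 2 ^ α := by
    rw [← hhalf]
    exact rpow_le_rpow hb.le (by linarith) hα.le
  have hconv := (convexOn_rpow (p := α + 1) (by linarith)).2
    (Set.mem_Ici.2 hc.le) (Set.mem_Ici.2 (half_pos hc).le)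
    (show 0 ≤ (a - b) / (a + b) from div_nonneg (by linarith) hc.le)
    (show 0 ≤ 2 * b / (a + b) by positivity) (by field_simp; ring)
  have hcomb : (a - b) / (a + b) * (a + b) + 2 * b / (a + b) * ((a + b) / 2) = a := by
    field_simp; ring
  simp only [smul_eq_mul] at hconv
  rw [hcomb, rpow_add_one ha.ne', rpow_add_one hc.ne', rpow_add_one (half_pos hc).ne',
    hhalf] at hconv
  have hrhs : (a - b) / (a + b) * ((a + b) ^ α * (a + b)) +
      2 * b / (a + b) * ((a + b) ^ α / 2 ^ α * ((a + b) / 2)) =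
      (a - b) * (a + b) ^ α + b * ((a + b) ^ α / 2 ^ α) := by
    field_simp
  rw [hrhs] at hconv
  have hexp : 1 + α / 2 ≤ (2 : ℝ) ^ α := by
    rw [rpow_def_of_pos (by norm_num)]
    have h1 := add_one_le_exp (log 2 * α)
    have h3 := mul_le_mul_of_nonneg_right log_two_gt_d9.le hα.le
    linarith
  have hkey : α * ((a + b) ^ α / 2 ^ α) ≤ 2 * (a + b) ^ α - 2 * ((a + b) ^ α / 2 ^ α) := by
    have hq : (a + b) ^ α = 2 ^ α * ((a + b) ^ α / 2 ^ α) := by field_simp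
    have hq0 : 0 ≤ (a + b) ^ α / 2 ^ α := by positivity
    nlinarith [mul_le_mul_of_nonneg_right hexp hq0]
  have hlhs : α / 2 ^ α * b * (a + b) ^ α = b * (α * ((a + b) ^ α / 2 ^ α)) := by ring
  rw [hlhs]
  nlinarith [mul_le_mul_of_nonneg_left hkey hb.le, mul_le_mul_of_nonneg_right hbα hb.le]

/-- The additivity defect of `x ↦ |x| ^ α * x` has the sign of `z * x * y`, where `z = x + y`,
and is bounded below in terms of the smallest and the largest of `|z|, |x|, |y|`. -/
def DefectBound (α x y z : ℝ) : Prop :=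
  α / 2 ^ α * min |z| (min |x| |y|) * max |z| (max |x| |y|) ^ α * |z * x * y| ≤
    (|z| ^ α * z - |x| ^ α * x - |y| ^ α * y) * (z * x * y)

lemma DefectBound.swap {α x y z : ℝ} (h : DefectBound α x y z) : DefectBound α y x z := by
  unfold DefectBound at *
  rw [min_comm |y|, max_comm |y|, mul_right_comm z y x]
  linarith

lemma DefectBound.neg {α x y z : ℝ} (h : DefectBound α x y z) :
    DefectBound α (-x) (-y) (-z) := by
  unfold DefectBound at *
  have hprod : -z * -x * -y = -(z * x * y) := by ring
  rw [hprod]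
  simp only [abs_neg]
  linarith

lemma DefectBound.rotate {α x y z : ℝ} (h : DefectBound α x y z) :
    DefectBound α z (-y) x := by
  unfold DefectBound at *
  have hprod : x * z * -y = -(z * x * y) := by ring
  rw [hprod]
  simp only [abs_neg]
  rw [min_left_comm, max_left_comm]
  linarith

lemma defectBound_of_pos {α : ℝ} (hα : 0 < α) {x y : ℝ} (hx : 0 < x) (hy : 0 < y) :
    DefectBound α x y (x + y) := by
  wlog hxy : y ≤ x generalizing x y
  · have := (this hy hx (le_of_not_ge hxy)).swap
    rwa [add_comm y x] at this
  have hz : 0 < x + y := by positivity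
  have hp : 0 < (x + y) * x * y := by positivity
  unfold DefectBound
  rw [abs_of_pos hx, abs_of_pos hy, abs_of_pos hz, abs_of_pos hp, min_eq_right hxy,
    max_eq_left hxy, min_eq_right (by linarith), max_eq_left (by linarith)]
  exact mul_le_mul_of_nonneg_right (defect_lower_bound_of_pos hα hy hxy) hp.le

lemma defectBound_of_pos_left {α : ℝ} (hα : 0 < α) {x y : ℝ} (hx : 0 < x) (hy : y ≠ 0)
    (hz : x + y ≠ 0) : DefectBound α x y (x + y) := by
  rcases hy.lt_or_gt with hy | hy
  · rcases hz.lt_or_gt with hz | hz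
    · have h := (defectBound_of_pos hα (neg_pos.2 hz) hx).neg.rotate.swap
      rwa [neg_neg, neg_neg, show -(-(x + y) + x) = y by ring] at h
    · have h := (defectBound_of_pos hα hz (neg_pos.2 hy)).rotate
      rwa [show x + y + -y = x by ring, neg_neg] at h
  · exact defectBound_of_pos hα hx hy

lemma defectBound {α : ℝ} (hα : 0 < α) {x y : ℝ} (hx : x ≠ 0) (hy : y ≠ 0)
    (hz : x + y ≠ 0) : DefectBound α x y (x + y) := by
  rcases hx.lt_or_gt with hx | hx
  · have h := (defectBound_of_pos_left hα (neg_pos.2 hx) (neg_ne_zero.2 hy)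
      (by rw [← neg_add]; exact neg_ne_zero.2 hz)).neg
    rwa [neg_add, neg_neg, neg_neg] at h
  · exact defectBound_of_pos_left hα hx hy hz

theorem resonance_identity_and_bound
    (α : ℝ) (hα : 0 < α)
    (k k₁ : ℤ) (hk : k ≠ 0) (hk₁ : k₁ ≠ 0) (hk₂ : k - k₁ ≠ 0)
    (τ τ₁ η η₁ : ℝ) :
    ((τ₁ - phi2 α k₁ η₁) + ((τ - τ₁) - phi2 α (k - k₁) (η - η₁)) - (τ - phi2 α k η)
        = (phi0 α k - phi0 α k₁ - phi0 α (k - k₁)) +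
            ((k : ℝ) * η₁ - (k₁ : ℝ) * η) ^ 2 / ((k : ℝ) * (k₁ : ℝ) * ((k : ℝ) - (k₁ : ℝ)))) ∧
    0 ≤ (phi0 α k - phi0 α k₁ - phi0 α (k - k₁)) *
          (((k : ℝ) * η₁ - (k₁ : ℝ) * η) ^ 2 / ((k : ℝ) * (k₁ : ℝ) * ((k : ℝ) - (k₁ : ℝ)))) ∧
    α / (3 * (2 : ℝ) ^ α) *
        min |(k : ℝ)| (min |(k₁ : ℝ)| |((k - k₁ : ℤ) : ℝ)|) *
        (max |(k : ℝ)| (max |(k₁ : ℝ)| |((k - k₁ : ℤ) : ℝ)|)) ^ α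
      ≤ max |τ - phi2 α k η|
          (max |τ₁ - phi2 α k₁ η₁| |(τ - τ₁) - phi2 α (k - k₁) (η - η₁)|) := by
  have hkR : (k : ℝ) ≠ 0 := Int.cast_ne_zero.2 hk
  have hk₁R : (k₁ : ℝ) ≠ 0 := Int.cast_ne_zero.2 hk₁
  have hk₂R : (k : ℝ) - k₁ ≠ 0 := by exact_mod_cast hk₂
  have hD : (k : ℝ) * k₁ * (k - k₁) ≠ 0 := mul_ne_zero (mul_ne_zero hkR hk₁R) hk₂R
  have hid : (τ₁ - phi2 α k₁ η₁) + ((τ - τ₁) - phi2 α (k - k₁) (η - η₁)) - (τ - phi2 α k η)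
      = (phi0 α k - phi0 α k₁ - phi0 α (k - k₁)) +
        ((k : ℝ) * η₁ - k₁ * η) ^ 2 / ((k : ℝ) * k₁ * (k - k₁)) := by
    have hquad : η₁ ^ 2 / (k₁ : ℝ) + (η - η₁) ^ 2 / ((k : ℝ) - k₁) - η ^ 2 / (k : ℝ) =
        ((k : ℝ) * η₁ - k₁ * η) ^ 2 / ((k : ℝ) * k₁ * (k - k₁)) := by
      field_simp
      ring
    rw [← hquad]
    unfold phi2
    push_cast
    ring
  have hbound := defectBound hα hk₁R hk₂R (by simpa using hkR)
  rw [add_sub_cancel] at hbound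
  unfold DefectBound at hbound
  have hr : phi0 α k - phi0 α k₁ - phi0 α (k - k₁) =
      |(k : ℝ)| ^ α * k - |(k₁ : ℝ)| ^ α * k₁ - |(k : ℝ) - k₁| ^ α * (k - k₁) := by
    simp only [phi0, Int.cast_sub]
  rw [← hr] at hbound
  rw [hid, Int.cast_sub]
  set r := phi0 α k - phi0 α k₁ - phi0 α (k - k₁)
  set D := (k : ℝ) * k₁ * (k - k₁)
  set s := (k : ℝ) * η₁ - k₁ * η
  set m := min |(k : ℝ)| (min |(k₁ : ℝ)| |(k : ℝ) - k₁|)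
  set M := max |(k : ℝ)| (max |(k₁ : ℝ)| |(k : ℝ) - k₁|)
  have hrD : 0 ≤ r * D := le_trans (by positivity) hbound
  have hsign : 0 ≤ r * (s ^ 2 / D) := by
    have : r * (s ^ 2 / D) = r * D * (s / D) ^ 2 := by field_simp
    rw [this]
    positivity
  refine ⟨rfl, hsign, ?_⟩
  have hle_r : α / 2 ^ α * m * M ^ α ≤ |r| := by
    refine le_of_mul_le_mul_right (hbound.trans ?_) (abs_pos.2 hD)
    rw [← abs_mul]
    exact le_abs_self _
  have hr_le : |r| ≤ |r + s ^ 2 / D| :=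
    sq_le_sq.1 (by nlinarith [sq_nonneg (s ^ 2 / D)])
  rw [← hid] at hr_le
  set σ := τ - phi2 α k η
  set σ₁ := τ₁ - phi2 α k₁ η₁
  set σ₂ := (τ - τ₁) - phi2 α (k - k₁) (η - η₁)
  have htri : |σ₁ + σ₂ - σ| ≤ |σ₁| + |σ₂| + |σ| :=
    (abs_sub _ _).trans (by gcongr; exact abs_add_le _ _)
  have h0 : |σ| ≤ max |σ| (max |σ₁| |σ₂|) := le_max_left _ _
  have h1 : |σ₁| ≤ max |σ| (max |σ₁| |σ₂|) := (le_max_left _ _).trans (le_max_right _ _)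
  have h2 : |σ₂| ≤ max |σ| (max |σ₁| |σ₂|) := (le_max_right _ _).trans (le_max_right _ _)
  have hthird : α / (3 * 2 ^ α) * m * M ^ α = α / 2 ^ α * m * M ^ α / 3 := by
    field_simp
  rw [hthird]
  linarith
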